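/- arXiv:1203.6615 — 3 statements merged into one kernel-verified Lean document; each statement's English description precedes it below -/
import Mathlib

section
/- Let D be a division ring and M ∈ Mat_m(D[x_1,...,x_n]) be strongly nilpotent with strong nilpotency index r exceeding the ordinary nilpotency index of M (the minimal k with Mᵏ = 0). Then 3 ≤ r ≤ m−1. -/
open MvPolynomial

/-- Substitute the `i`-th fresh tuple of indeterminates for `x` in every entry of `M`. -/
noncomputable def substN {K : Type} [CommRing K] {n m : ℕ}
    (M : Matrix (Fin m) (Fin m) (MvPolynomial (Fin n) K)) (i : ℕ) :
    Matrix (Fin m) (Fin m) (MvPolynomial (ℕ × Fin n) K) :=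
  M.map (rename fun k => (i, k))

/-- The product `M|_{x=y⁽ʳ⁾} ⬝ ⋯ ⬝ M|_{x=y⁽¹⁾}` (fresh tuples indexed `r-1, …, 0`). -/
noncomputable def prodSubst {K : Type} [CommRing K] {n m : ℕ}
    (M : Matrix (Fin m) (Fin m) (MvPolynomial (Fin n) K)) (r : ℕ) :
    Matrix (Fin m) (Fin m) (MvPolynomial (ℕ × Fin n) K) :=
  ((List.range r).reverse.map (substN M)).prod

open Matrix in
/-- The row vectors over `K` that are killed on the right by every product of `j` coefficient
matrices of `M`. -/
noncomputable def rowKer {K : Type} [Field K] {n m : ℕ}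
    (M : Matrix (Fin m) (Fin m) (MvPolynomial (Fin n) K)) : ℕ → Submodule K (Fin m → K)
  | 0 => ⊥
  | j + 1 => ⨅ α, (rowKer M j).comap (vecMulLinear (M.map (coeff α)))

section

open Matrix

variable {K : Type} [Field K] {n m : ℕ} (M : Matrix (Fin m) (Fin m) (MvPolynomial (Fin n) K))

theorem mem_rowKer_succ {j : ℕ} {v : Fin m → K} :
    v ∈ rowKer M (j + 1) ↔ ∀ α, v ᵥ* M.map (coeff α) ∈ rowKer M j := by
  simp [rowKer, Submodule.mem_iInf]

theorem rowKer_le_succ (j : ℕ) : rowKer M j ≤ rowKer M (j + 1) := by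
  induction j with
  | zero => exact bot_le
  | succ j ih =>
    intro v hv
    rw [mem_rowKer_succ] at hv ⊢
    exact fun α => ih (hv α)

theorem rowKer_add_eq {j : ℕ} (h : rowKer M j = rowKer M (j + 1)) (d : ℕ) :
    rowKer M (j + d) = rowKer M j := by
  induction d with
  | zero => rfl
  | succ d ih =>
    rw [h]
    ext v
    rw [← add_assoc, mem_rowKer_succ, mem_rowKer_succ, ih]

theorem prodSubst_succ (j : ℕ) : prodSubst M (j + 1) = substN M j * prodSubst M j := by
  simp [prodSubst, List.range_succ]

/-- Regard the `s`-th tuple of indeterminates as the variables, and all others as constants. -/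
noncomputable def isolateTuple (K : Type) [Field K] (n s : ℕ) :
    MvPolynomial (ℕ × Fin n) K →ₐ[K] MvPolynomial (Fin n) (MvPolynomial (ℕ × Fin n) K) :=
  aeval fun a => if a.1 = s then X a.2 else C (X a)

theorem isolateTuple_rename_self (s : ℕ) (p : MvPolynomial (Fin n) K) :
    isolateTuple K n s (rename (fun k => (s, k)) p) = map C p := by
  induction p using MvPolynomial.induction_on with
  | C a => simp [isolateTuple, algHom_C, MvPolynomial.algebraMap_apply]
  | add p q hp hq => simp [hp, hq]
  | mul_X p i hp => rw [map_mul, map_mul, map_mul, hp]; simp [isolateTuple]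

theorem isolateTuple_rename_of_ne {s i : ℕ} (h : i ≠ s) (p : MvPolynomial (Fin n) K) :
    isolateTuple K n s (rename (fun k => (i, k)) p) = C (rename (fun k => (i, k)) p) := by
  induction p using MvPolynomial.induction_on with
  | C a => simp [isolateTuple, algHom_C, MvPolynomial.algebraMap_apply]
  | add p q hp hq => simp [hp, hq]
  | mul_X p k hp => rw [map_mul, map_mul, map_mul, hp]; simp [isolateTuple, h]

theorem eval_map_C (s : ℕ) (p : MvPolynomial (Fin n) K) :
    eval (fun k => (X (s, k) : MvPolynomial (ℕ × Fin n) K)) (map C p) =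
      rename (fun k => (s, k)) p := by
  induction p using MvPolynomial.induction_on with
  | C a => simp
  | add p q hp hq => simp [hp, hq]
  | mul_X p k hp => simp [hp]

theorem isolateTuple_prodSubst {s j : ℕ} (h : j ≤ s) :
    (prodSubst M j).map (isolateTuple K n s) = (prodSubst M j).map C := by
  induction j with
  | zero =>
    simp only [prodSubst, List.range_zero, List.reverse_nil, List.map_nil, List.prod_nil]
    rw [Matrix.map_one _ (map_zero _) (map_one _), Matrix.map_one _ (map_zero _) (map_one _)]
  | succ j ih =>
    rw [prodSubst_succ, Matrix.map_mul, Matrix.map_mul, ih (by omega)]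
    congr 1
    ext1 a b
    exact isolateTuple_rename_of_ne (by omega) _

theorem mem_rowKer_iff {j : ℕ} {v : Fin m → K} :
    v ∈ rowKer M j ↔ (fun i => C (v i)) ᵥ* prodSubst M j = 0 := by
  induction j generalizing v with
  | zero =>
    simp [rowKer, prodSubst, funext_iff]
  | succ j ih =>
    rw [mem_rowKer_succ]
    simp only [ih]
    rw [prodSubst_succ, ← vecMul_vecMul]
    let F : Fin m → MvPolynomial (Fin n) (MvPolynomial (ℕ × Fin n) K) := fun b =>
      ∑ a, (∑ i, C (C (v i)) * map C (M i a)) * C (prodSubst M j a b)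
    have hF : ∀ b, isolateTuple K n j
        (((fun i => C (v i)) ᵥ* substN M j ᵥ* prodSubst M j) b) = F b := by
      intro b
      simp only [vecMul, dotProduct, F, map_sum, map_mul, substN, Matrix.map_apply,
        isolateTuple_rename_self]
      refine Finset.sum_congr rfl fun a _ => ?_
      congr 1
      · refine Finset.sum_congr rfl fun i _ => ?_
        simp [isolateTuple, algHom_C, MvPolynomial.algebraMap_apply]
      · exact congrFun₂ (isolateTuple_prodSubst M le_rfl) a b
    have hE : ∀ b, eval (fun k => X (j, k)) (F b) =
        ((fun i => C (v i)) ᵥ* substN M j ᵥ* prodSubst M j) b := by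
      intro b
      simp only [vecMul, dotProduct, F, map_sum, map_mul, substN, Matrix.map_apply, eval_C,
        eval_map_C]
    have hc : ∀ b α, coeff α (F b) =
        ((fun i => C ((v ᵥ* M.map (coeff α)) i)) ᵥ* prodSubst M j) b := by
      intro b α
      simp only [vecMul, dotProduct, F, coeff_sum, Matrix.map_apply, map_sum, map_mul]
      refine Finset.sum_congr rfl fun a _ => ?_
      rw [mul_comm, coeff_C_mul, mul_comm]
      simp only [coeff_sum, coeff_C_mul, coeff_map]
    constructor
    · intro h
      ext1 b
      rw [← hE]
      have : F b = 0 := by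
        ext1 α
        rw [hc, h]
        simp
      simp [this]
    · intro h α
      ext1 b
      rw [← hc, ← hF, h]
      simp

theorem prodSubst_eq_zero_iff {j : ℕ} : prodSubst M j = 0 ↔ rowKer M j = ⊤ := by
  rw [Submodule.eq_top_iff']
  constructor
  · intro h v
    simp [mem_rowKer_iff, h]
  · intro h
    ext1 a b
    have := congrFun ((mem_rowKer_iff M).1 (h (Pi.single a 1))) b
    have hs : (fun i => C ((Pi.single a 1 : Fin m → K) i)) =
        (Pi.single a 1 : Fin m → MvPolynomial (ℕ × Fin n) K) := by
      ext1 i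
      by_cases hi : i = a
      · subst hi; simp
      · simp [hi]
    rw [hs, single_one_vecMul] at this
    exact this

theorem rowKer_lt_succ {r : ℕ} (h0 : prodSubst M r = 0) (hmin : ∀ r' < r, prodSubst M r' ≠ 0)
    {j : ℕ} (hj : j < r) : rowKer M j < rowKer M (j + 1) := by
  refine lt_of_le_of_ne (rowKer_le_succ M j) fun h => hmin j hj ?_
  rw [prodSubst_eq_zero_iff, ← rowKer_add_eq M h (r - j), Nat.add_sub_cancel' hj.le,
    ← prodSubst_eq_zero_iff, h0]

theorem finrank_rowKer_add_le {r : ℕ} (h0 : prodSubst M r = 0)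
    (hmin : ∀ r' < r, prodSubst M r' ≠ 0) {i d : ℕ} (h : i + d ≤ r) :
    Module.finrank K (rowKer M i) + d ≤ Module.finrank K (rowKer M (i + d)) := by
  induction d with
  | zero => rfl
  | succ d ih =>
    have := ih (by omega)
    have := Submodule.finrank_lt_finrank_of_lt (rowKer_lt_succ M h0 hmin (j := i + d) (by omega))
    rw [← add_assoc i]
    omega

theorem coeff_vecMul (u : Fin m → MvPolynomial (Fin n) K) (γ : Fin n →₀ ℕ) :
    (fun i => coeff γ ((u ᵥ* M) i)) =
      ∑ x ∈ Finset.HasAntidiagonal.antidiagonal γ, (fun i => coeff x.1 (u i)) ᵥ* M.map (coeff x.2) := by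
  ext1 b
  simp only [vecMul, dotProduct, coeff_sum, coeff_mul, Finset.sum_apply, Matrix.map_apply]
  exact Finset.sum_comm

/-- Extension of a linear form on `K ^ m` to vectors of polynomials. -/
noncomputable def extendForm (ψ : (Fin m → K) →ₗ[K] K) (u : Fin m → MvPolynomial (Fin n) K) :
    MvPolynomial (Fin n) K :=
  ∑ i, C (ψ (Pi.single i 1)) * u i

theorem coeff_extendForm (ψ : (Fin m → K) →ₗ[K] K) (u : Fin m → MvPolynomial (Fin n) K)
    (β : Fin n →₀ ℕ) : coeff β (extendForm ψ u) = ψ fun i => coeff β (u i) := by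
  rw [LinearMap.pi_apply_eq_sum_univ ψ]
  simp only [extendForm, coeff_sum, coeff_C_mul, smul_eq_mul]
  refine Finset.sum_congr rfl fun i _ => ?_
  rw [mul_comm]
  congr 2
  ext1 j
  simp [Pi.single_apply, eq_comm]

theorem smul_sub_smul_mem_of_finrank_le {V : Type*} [AddCommGroup V] [Module K V]
    [FiniteDimensional K V] {S T : Submodule K V} (hST : S ≤ T)
    (hd : Module.finrank K T ≤ Module.finrank K S + 1) {v : V} (hv : v ∈ T) (hvS : v ∉ S)
    {φ : V →ₗ[K] K} (hφ : S ≤ LinearMap.ker φ) {x : V} (hx : x ∈ T) :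
    φ v • x - φ x • v ∈ S := by
  have hlt : S < S ⊔ K ∙ v := by
    refine lt_of_le_of_ne le_sup_left fun h => hvS ?_
    rw [h]
    exact Submodule.mem_sup_right (Submodule.mem_span_singleton_self v)
  have heq : S ⊔ K ∙ v = T := by
    refine Submodule.eq_of_le_of_finrank_le
      (sup_le hST ((Submodule.span_singleton_le_iff_mem _ _).2 hv)) ?_
    have := Submodule.finrank_lt_finrank_of_lt hlt
    omega
  rw [← heq, Submodule.mem_sup] at hx
  obtain ⟨s, hs, y, hy, rfl⟩ := hx
  obtain ⟨c, rfl⟩ := Submodule.mem_span_singleton.1 hy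
  have hφs : φ s = 0 := hφ hs
  have : φ v • (s + c • v) - φ (s + c • v) • v = φ v • s := by
    rw [map_add, hφs, map_smul, smul_add, smul_smul, smul_eq_mul, zero_add, mul_comm c]
    abel
  rw [this]
  exact S.smul_mem _ hs

theorem vecMul_pow_ne_zero {j : ℕ}
    (hd : ∀ i ≤ j, Module.finrank K (rowKer M (i + 1)) ≤ Module.finrank K (rowKer M i) + 1)
    {u : Fin m → MvPolynomial (Fin n) K}
    (hu : ∀ β, (fun i => coeff β (u i)) ∈ rowKer M (j + 1))
    (hu' : ∃ β, (fun i => coeff β (u i)) ∉ rowKer M j) :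
    u ᵥ* M ^ j ≠ 0 := by
  induction j generalizing u with
  | zero =>
    rintro h
    obtain ⟨β, hβ⟩ := hu'
    rw [pow_zero, vecMul_one] at h
    apply hβ
    simp only [h, Pi.zero_apply, coeff_zero]
    exact zero_mem _
  | succ j ih =>
    rw [pow_succ', ← vecMul_vecMul]
    refine ih (fun i hi => hd i (by omega)) ?_ ?_
    · intro γ
      rw [coeff_vecMul]
      exact Submodule.sum_mem _ fun x _ => (mem_rowKer_succ M).1 (hu x.1) x.2
    · obtain ⟨β, hβ⟩ := hu'
      set v : Fin m → K := fun i => coeff β (u i) with hv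
      obtain ⟨φ, hφv, hφ⟩ := Submodule.exists_le_ker_of_notMem hβ
      obtain ⟨α, hα⟩ : ∃ α, v ᵥ* M.map (coeff α) ∉ rowKer M j := by
        by_contra! h
        exact hβ ((mem_rowKer_succ M).2 h)
      obtain ⟨ψ, hψv, hψ⟩ := Submodule.exists_le_ker_of_notMem hα
      by_contra! h
      have key : extendForm φ u * extendForm ψ ((fun i => C (v i)) ᵥ* M) =
          C (φ v) * extendForm ψ (u ᵥ* M) := by
        ext1 γ
        rw [coeff_mul, coeff_C_mul, coeff_extendForm, coeff_vecMul, map_sum, Finset.mul_sum]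
        refine Finset.sum_congr rfl fun x _ => ?_
        have hvM : (fun i => coeff x.2 (((fun i => C (v i)) ᵥ* M) i)) =
            v ᵥ* M.map (coeff x.2) := by
          ext1 b
          simp [vecMul, dotProduct, coeff_sum, coeff_C_mul]
        rw [coeff_extendForm, coeff_extendForm, hvM]
        have hmem := smul_sub_smul_mem_of_finrank_le (rowKer_le_succ M (j + 1)) (hd _ le_rfl)
          (hu β) hβ hφ (hu x.1)
        have h0 := hψ ((mem_rowKer_succ M).1 hmem x.2)
        rw [LinearMap.mem_ker, sub_vecMul, smul_vecMul, smul_vecMul, map_sub, map_smul,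
          map_smul, smul_eq_mul, smul_eq_mul, sub_eq_zero] at h0
        exact h0.symm
      have hz : extendForm ψ (u ᵥ* M) = 0 := by
        ext1 γ
        rw [coeff_extendForm, coeff_zero]
        exact hψ (h γ)
      rw [hz, mul_zero, mul_eq_zero] at key
      rcases key with hk | hk
      · have := congrArg (coeff β) hk
        rw [coeff_extendForm, coeff_zero] at this
        exact hφv this
      · have := congrArg (coeff α) hk
        rw [coeff_extendForm, coeff_zero] at this
        apply hψv
        rw [← this]
        congr 1
        ext1 b
        simp [vecMul, dotProduct, coeff_sum, coeff_C_mul]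

end

theorem stmt7 {K : Type} [Field K] {m n r k : ℕ}
    (M : Matrix (Fin m) (Fin m) (MvPolynomial (Fin n) K))
    (h0 : prodSubst M r = 0)
    (hmin : ∀ r' < r, prodSubst M r' ≠ 0)
    (hk : M ^ k = 0) (hkmin : ∀ k' < k, M ^ k' ≠ 0)
    (hlt : k < r) :
    3 ≤ r ∧ r ≤ m - 1 := by
  have h3 : 3 ≤ r := by
    by_contra! h
    have hM : M = 0 := by
      have := pow_eq_zero_of_le (show k ≤ 1 by omega) hk
      rwa [pow_one] at this
    have h1 : prodSubst M 1 = 0 := by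
      rw [prodSubst_succ, hM]
      rw [substN, Matrix.map_zero _ (map_zero _), zero_mul]
    have hr : r = 1 := by
      by_contra hr
      exact hmin 1 (by omega) h1
    have hk0 : k = 0 := by omega
    rw [hk0, pow_zero] at hk
    apply hmin 0 (by omega)
    ext1 a b
    have := congrFun₂ hk a a
    simp at this
  refine ⟨h3, ?_⟩
  have htop : Module.finrank K (rowKer M r) = m := by
    rw [(prodSubst_eq_zero_iff M).1 h0]
    simp
  have hrm : r ≤ m := by
    have := finrank_rowKer_add_le M h0 hmin (i := 0) (d := r) (by omega)
    rw [zero_add, htop] at this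
    omega
  by_contra! h
  have hr : r = m := by omega
  obtain ⟨s, rfl⟩ : ∃ s, r = s + 1 := ⟨r - 1, by omega⟩
  obtain ⟨v, hv, hvs⟩ := SetLike.exists_of_lt (rowKer_lt_succ M h0 hmin (Nat.lt_succ_self s))
  refine vecMul_pow_ne_zero M (j := s) (u := fun i => C (v i)) (fun i hi => ?_) (fun β => ?_)
    ⟨0, by simpa using hvs⟩ ?_
  · have hlow := finrank_rowKer_add_le M h0 hmin (i := 0) (d := i) (by omega)
    have hup := finrank_rowKer_add_le M h0 hmin (i := i + 1) (d := s - i) (by omega)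
    rw [show i + 1 + (s - i) = s + 1 by omega, htop] at hup
    rw [zero_add] at hlow
    omega
  · rw [(prodSubst_eq_zero_iff M).1 h0]
    trivial
  · rw [pow_eq_zero_of_le (by omega) hk, Matrix.vecMul_zero]
end

section
/- Let R be a reduced commutative ring with unity, S a set, and M an m×m matrix of functions from S to R. If there exists r ∈ ℕ such that M|_{v_r}·M|_{v_{r−1}}···M|_{v_1} = 0 for all v_i ∈ S, then M|_{v_m}·M|_{v_{m−1}}···M|_{v_1} = 0 for all v_i ∈ S. -/
/-- Evaluate every entry of a matrix of functions `S → R` at `v : S`. -/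
def evalM {R : Type} [Ring R] {S : Type} {m : ℕ}
    (M : Matrix (Fin m) (Fin m) (S → R)) (v : S) : Matrix (Fin m) (Fin m) R :=
  M.map fun f => f v

/-- The product `M|_{v_r} ⬝ M|_{v_{r-1}} ⬝ ⋯ ⬝ M|_{v_1}` (0-based: `v` indexed `r-1, …, 0`). -/
def evalProd {R : Type} [Ring R] {S : Type} {m r : ℕ}
    (M : Matrix (Fin m) (Fin m) (S → R)) (v : Fin r → S) : Matrix (Fin m) (Fin m) R :=
  ((List.ofFn fun i => evalM M (v i)).reverse).prod

/-- The `n`-th term of the ascending chain of common kernels of a family of endomorphisms: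
the vectors killed by every composition of `n` members of the family. -/
def commonKer {K V ι : Type*} [Field K] [AddCommGroup V] [Module K V]
    (A : ι → Module.End K V) : ℕ → Submodule K V
  | 0 => ⊥
  | n + 1 => ⨅ i, (commonKer A n).comap (A i)

section commonKer

variable {K V ι : Type*} [Field K] [AddCommGroup V] [Module K V] (A : ι → Module.End K V)

lemma mem_commonKer_succ {n : ℕ} {x : V} :
    x ∈ commonKer A (n + 1) ↔ ∀ i, A i x ∈ commonKer A n := by
  simp [commonKer]

lemma mem_commonKer_iff {n : ℕ} {x : V} :
    x ∈ commonKer A n ↔ ∀ v : Fin n → ι, (List.ofFn fun i => A (v i)).reverse.prod x = 0 := by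
  induction n generalizing x with
  | zero => simp [commonKer]
  | succ n ih =>
    simp only [mem_commonKer_succ, ih, Fin.forall_fin_succ_pi, List.ofFn_succ, Fin.cons_zero,
      Fin.cons_succ, List.reverse_cons, List.prod_append, List.prod_singleton, Module.End.mul_apply]

lemma commonKer_eq_top_iff {n : ℕ} :
    commonKer A n = ⊤ ↔ ∀ v : Fin n → ι, (List.ofFn fun i => A (v i)).reverse.prod = 0 := by
  simp only [Submodule.eq_top_iff', mem_commonKer_iff, LinearMap.ext_iff, LinearMap.zero_apply]
  exact forall_comm

lemma commonKer_mono : Monotone (commonKer A) := by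
  refine monotone_nat_of_le_succ fun n => ?_
  induction n with
  | zero => exact bot_le
  | succ n ih => exact iInf_mono fun i => Submodule.comap_mono ih

lemma commonKer_eq_of_eq_succ {n k : ℕ} (h : commonKer A n = commonKer A (n + 1)) (hk : n ≤ k) :
    commonKer A k = commonKer A n := by
  induction k, hk using Nat.le_induction with
  | base => rfl
  | succ k _ ih => rw [h, commonKer, ih, ← commonKer]

lemma commonKer_finrank_eq_top [FiniteDimensional K V] {r : ℕ} (hr : commonKer A r = ⊤) :
    commonKer A (Module.finrank K V) = ⊤ := by
  have key (n : ℕ) : n ≤ Module.finrank K (commonKer A n) ∨ commonKer A n = ⊤ := by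
    induction n with
    | zero => exact Or.inl (Nat.zero_le _)
    | succ n ih =>
      have hle := commonKer_mono A n.le_succ
      rcases ih with ih | ih
      · rcases hle.eq_or_lt with h | h
        · refine Or.inr (h ▸ top_le_iff.mp ?_)
          rw [← hr, ← commonKer_eq_of_eq_succ A h (le_max_left n r)]
          exact commonKer_mono A (le_max_right n r)
        · exact Or.inl (ih.trans_lt (Submodule.finrank_lt_finrank_of_lt h))
      · exact Or.inr (top_le_iff.mp (ih ▸ hle))
  exact (key _).elim
    (fun h => Submodule.eq_top_of_finrank_eq (le_antisymm (Submodule.finrank_le _) h)) id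

end commonKer

lemma Matrix.prod_reverse_ofFn_eq_zero {K ι n : Type*} [Field K] [Fintype n] [DecidableEq n]
    (A : ι → Matrix n n K) {r : ℕ}
    (h : ∀ v : Fin r → ι, (List.ofFn fun i => A (v i)).reverse.prod = 0)
    (v : Fin (Fintype.card n) → ι) : (List.ofFn fun i => A (v i)).reverse.prod = 0 := by
  have key (k : ℕ) (v : Fin k → ι) :
      (List.ofFn fun i => Matrix.toLinAlgEquiv' (A (v i))).reverse.prod =
        Matrix.toLinAlgEquiv' (List.ofFn fun i => A (v i)).reverse.prod := by
    rw [map_list_prod, List.map_reverse, List.map_ofFn]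
    rfl
  have hr : commonKer (fun i => Matrix.toLinAlgEquiv' (A i)) r = ⊤ :=
    (commonKer_eq_top_iff _).2 fun v => by rw [key, h, map_zero]
  have := commonKer_finrank_eq_top _ hr
  rw [Module.finrank_fintype_fun_eq_card, commonKer_eq_top_iff] at this
  simpa only [key, EmbeddingLike.map_eq_zero_iff] using this v

lemma mapMatrix_evalProd {R K : Type} [Ring R] [Ring K] {S : Type} {m r : ℕ} (f : R →+* K)
    (M : Matrix (Fin m) (Fin m) (S → R)) (v : Fin r → S) :
    f.mapMatrix (evalProd M v) =
      (List.ofFn fun i => f.mapMatrix (evalM M (v i))).reverse.prod := by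
  rw [evalProd, map_list_prod, List.map_reverse, List.map_ofFn]
  rfl

theorem stmt13 {R : Type} [CommRing R] [IsReduced R] {S : Type} {m : ℕ}
    (M : Matrix (Fin m) (Fin m) (S → R))
    (h : ∃ r : ℕ, ∀ v : Fin r → S, evalProd M v = 0) :
    ∀ v : Fin m → S, evalProd M v = 0 := by
  obtain ⟨r, hr⟩ := h
  intro v
  ext i j
  refine (nilpotent_iff_mem_prime.2 fun p hp => ?_ : IsNilpotent (evalProd M v i j)).eq_zero
  let f := algebraMap R p.ResidueField
  have hv := Matrix.prod_reverse_ofFn_eq_zero (fun s => f.mapMatrix (evalM M s)) (r := r)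
    fun w => by rw [← mapMatrix_evalProd, hr, map_zero]
  rw [Fintype.card_fin] at hv
  have hM : f.mapMatrix (evalProd M v) = 0 := (mapMatrix_evalProd f M v).trans (hv v)
  exact Ideal.algebraMap_residueField_eq_zero.1 (congrFun (congrFun hM i) j)
end

section
/- Let K be a field of characteristic zero and x + H a quasi-translation over K with rank(JH) = 1 (rank over the fraction field K(x)). Then (JH)·(JH)|_{x=y} = 0, i.e., JH has strong nilpotency index at most two. -/
open MvPolynomial

/-- The Jacobian matrix `(∂H_i/∂x_j)` of a polynomial map `H`. -/
noncomputable def jac {K : Type} [CommRing K] {n : ℕ}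
    (H : Fin n → MvPolynomial (Fin n) K) :
    Matrix (Fin n) (Fin n) (MvPolynomial (Fin n) K) :=
  Matrix.of fun i j => pderiv j (H i)

/-- `(JH)|_{x=x}`: the Jacobian, viewed in the larger ring with variables `x ⊕ y`. -/
noncomputable def jacX {K : Type} [CommRing K] {n : ℕ}
    (H : Fin n → MvPolynomial (Fin n) K) :
    Matrix (Fin n) (Fin n) (MvPolynomial (Fin n ⊕ Fin n) K) :=
  (jac H).map (rename Sum.inl)

/-- `(JH)|_{x=y}`: the Jacobian with the fresh tuple `y` substituted for `x`. -/
noncomputable def jacY {K : Type} [CommRing K] {n : ℕ}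
    (H : Fin n → MvPolynomial (Fin n) K) :
    Matrix (Fin n) (Fin n) (MvPolynomial (Fin n ⊕ Fin n) K) :=
  (jac H).map (rename Sum.inr)

/-- `H(y)`: the map `H` with the fresh tuple `y` substituted for `x`. -/
noncomputable def HY {K : Type} [CommRing K] {n : ℕ}
    (H : Fin n → MvPolynomial (Fin n) K) : Fin n → MvPolynomial (Fin n ⊕ Fin n) K :=
  fun i => rename Sum.inr (H i)

/-- An algebraic element over a subring of characteristic zero is a simple root of some polynomial. -/
theorem IsAlgebraic.exists_simple_root {R A : Type*} [CommRing R] [IsDomain R] [CharZero R]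
    [CommRing A] [Algebra R A] [FaithfulSMul R A] {a : A}
    (ha : IsAlgebraic R a) :
    ∃ p : Polynomial R, Polynomial.aeval a p = 0 ∧
      Polynomial.aeval a (Polynomial.derivative p) ≠ 0 := by
  classical
  have hex : ∃ d, ∃ p : Polynomial R, p ≠ 0 ∧ Polynomial.aeval a p = 0 ∧ p.natDegree = d := by
    obtain ⟨p, hp, hpa⟩ := ha
    exact ⟨_, p, hp, hpa, rfl⟩
  obtain ⟨p, hp, hpa, hd⟩ := Nat.find_spec hex
  have hpos : 0 < p.natDegree := by
    rw [Nat.pos_iff_ne_zero]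
    intro h0
    rw [Polynomial.eq_C_of_natDegree_eq_zero h0] at hp hpa
    rw [Polynomial.aeval_C, FaithfulSMul.algebraMap_eq_zero_iff] at hpa
    simp [hpa] at hp
  refine ⟨p, hpa, fun h => ?_⟩
  have hlt := Polynomial.natDegree_derivative_lt hpos.ne'
  refine Nat.find_min hex (hd ▸ hlt) ⟨_, fun h0 => ?_, h, rfl⟩
  exact hpos.ne' (Polynomial.derivative_eq_zero.1 h0)

/-- In characteristic zero a derivation that kills `s` kills every element algebraic over
the subalgebra generated by `s`. -/
theorem Derivation.eq_zero_of_isAlgebraic_adjoin {K A : Type*} [Field K] [CharZero K] [CommRing A]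
    [IsDomain A] [Algebra K A] (D : Derivation K A A) {s : Set A} (hs : ∀ b ∈ s, D b = 0) {a : A}
    (ha : IsAlgebraic (Algebra.adjoin K s) a) : D a = 0 := by
  have hker : ∀ b ∈ Algebra.adjoin K s, D b = 0 := by
    intro b hb
    induction hb using Algebra.adjoin_induction with
    | mem x hx => exact hs x hx
    | algebraMap r => exact D.map_algebraMap r
    | add x y _ _ hx hy => simp [hx, hy]
    | mul x y _ _ hx hy => simp [hx, hy]
  have : CharZero (Algebra.adjoin K s) := Algebra.charZero_of_charZero K _
  obtain ⟨p, hp, hp'⟩ := ha.exists_simple_root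
  let D' : Derivation (Algebra.adjoin K s) A A := Derivation.mk'
    { toFun := D
      map_add' := D.map_add
      map_smul' := fun r x => by
        simp [Subalgebra.smul_def, hker r r.2] }
    (fun x y => D.leibniz x y)
  have h := D'.map_aeval p a
  rw [hp, map_zero, smul_eq_mul, eq_comm, mul_eq_zero] at h
  exact h.resolve_left hp'

/-- Polynomials with parallel gradients are algebraically dependent. -/
theorem MvPolynomial.isAlgebraic_adjoin_of_pderiv_mul_eq {K : Type*} [Field K] [CharZero K] {n : ℕ}
    {f g : MvPolynomial (Fin n) K} {i : Fin n} (hf : pderiv i f ≠ 0)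
    (hfg : ∀ j k, pderiv j f * pderiv k g = pderiv k f * pderiv j g) :
    IsAlgebraic (Algebra.adjoin K {f}) g := by
  by_contra hg
  have hf' : AlgebraicIndepOn K id ({f} : Set (MvPolynomial (Fin n) K)) := by
    rw [← insert_empty_eq]
    refine AlgebraicIndepOn.insert ?_ fun h => hf ?_
    · exact algebraicIndependent_empty_type_iff.2 (algebraMap K _).injective
    · exact (pderiv i).eq_zero_of_isAlgebraic_adjoin (by simp) h
  have hind : AlgebraicIndepOn K id ({g, f} : Set (MvPolynomial (Fin n) K)) := by
    refine hf'.insert ?_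
    rw [Set.image_id]
    exact hg
  have htop : Algebra.adjoin K ({g, f} ∪ Set.range X : Set (MvPolynomial (Fin n) K)) = ⊤ := by
    rw [eq_top_iff, ← adjoin_range_X]
    exact Algebra.adjoin_mono Set.subset_union_right
  have : Algebra.IsAlgebraic
      (Algebra.adjoin K ({g, f} ∪ Set.range X : Set (MvPolynomial (Fin n) K)))
      (MvPolynomial (Fin n) K) := by
    refine ⟨fun x => ?_⟩
    have hx : x ∈ Algebra.adjoin K ({g, f} ∪ Set.range X : Set (MvPolynomial (Fin n) K)) := by
      rw [htop]; trivial
    exact isAlgebraic_algebraMap (A := MvPolynomial (Fin n) K) (⟨x, hx⟩ : Algebra.adjoin K _)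
  obtain ⟨u, hsu, -, hu⟩ := exists_isTranscendenceBasis_between (R := K) {g, f}
    ({g, f} ∪ Set.range X) Set.subset_union_left hind
  have hcard : Cardinal.mk u = n := by
    have h1 := hu.lift_cardinalMk_eq (IsTranscendenceBasis.mvPolynomial (Fin n) K)
    simpa using h1
  have hufin : u.Finite := Cardinal.lt_aleph0_iff_set_finite.1 (hcard ▸ Cardinal.natCast_lt_aleph0)
  have : Fintype u := hufin.fintype
  have hcard' : Fintype.card u = n := by
    rw [Cardinal.mk_fintype] at hcard
    exact_mod_cast hcard
  have hgu : g ∈ u := hsu (by simp)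
  have hfg_ne : f ≠ g := by
    rintro rfl
    exact hg (isAlgebraic_algebraMap (A := MvPolynomial (Fin n) K)
      (⟨f, Algebra.subset_adjoin rfl⟩ : Algebra.adjoin K {f}))
  classical
  let T : (Fin n → MvPolynomial (Fin n) K) →ₗ[MvPolynomial (Fin n) K]
      ({b : u // b ≠ ⟨g, hgu⟩} → MvPolynomial (Fin n) K) :=
    Matrix.mulVecLin (Matrix.of fun b j => pderiv j (b.1 : MvPolynomial (Fin n) K))
  have hT : ¬ Function.Injective T := by
    intro h
    have h1 := card_le_of_injective _ T h
    have h2 := Fintype.card_subtype_lt (p := fun b : u => b ≠ ⟨g, hgu⟩) (x := ⟨g, hgu⟩) (by simp)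
    rw [Fintype.card_fin] at h1
    omega
  rw [← LinearMap.ker_eq_bot, Submodule.eq_bot_iff] at hT
  push Not at hT
  obtain ⟨v, hv, hv0⟩ := hT
  let D : Derivation K (MvPolynomial (Fin n) K) (MvPolynomial (Fin n) K) := mkDerivation K v
  have hsum : ∀ p, (∑ j, v j • pderiv (R := K) j) p = ∑ j, v j * pderiv j p := fun p =>
    (congrFun (map_sum (Derivation.coeFnAddMonoidHom (R := K) (A := MvPolynomial (Fin n) K)
      (M := MvPolynomial (Fin n) K)) _ _) p).trans (by
        simp [Finset.sum_apply, Derivation.coeFnAddMonoidHom])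
  have hD : ∀ p, D p = ∑ j, pderiv j p * v j := by
    have : D = ∑ j, v j • pderiv j := by
      refine derivation_ext fun k => ?_
      simp [D, mkDerivation_X, hsum, pderiv_X, Pi.single_apply]
    intro p
    simp [this, hsum, mul_comm]
  have hDu : ∀ b ∈ u, b ≠ g → D b = 0 := by
    intro b hb hbg
    rw [hD]
    exact congrFun (LinearMap.mem_ker.1 hv) ⟨⟨b, hb⟩, by simpa using hbg⟩
  have hDf : D f = 0 := hDu f (hsu (by simp)) hfg_ne
  have hDg : D g = 0 := by
    refine (mul_eq_zero.1 (?_ : pderiv i f * D g = 0)).resolve_left hf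
    rw [hD] at hDf ⊢
    rw [Finset.mul_sum]
    calc ∑ j, pderiv i f * (pderiv j g * v j) = pderiv i g * ∑ j, pderiv j f * v j := by
          rw [Finset.mul_sum]
          refine Finset.sum_congr rfl fun j _ => ?_
          linear_combination v j * hfg i j
      _ = 0 := by rw [hDf, mul_zero]
  have halg := hu.isAlgebraic
  rw [Subtype.range_coe] at halg
  refine hv0 (_root_.funext fun j => ?_)
  have := D.eq_zero_of_isAlgebraic_adjoin (s := u) (fun b hb => ?_) (halg.isAlgebraic (X j))
  · simpa [D, mkDerivation_X] using this
  · by_cases hbg : b = g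
    · rw [hbg, hDg]
    · exact hDu b hb hbg

/-- Two sections of an algebra map that agree on `f` agree on everything algebraic over `f`. -/
theorem AlgHom.eq_of_section_of_isAlgebraic {K A B : Type*} [Field K] [CharZero K]
    [CommRing A] [IsDomain A] [Algebra K A] [CommRing B] [IsDomain B] [Algebra K B]
    (α β : A →ₐ[K] B) (δ : B →ₐ[K] A) (hα : δ.comp α = AlgHom.id K A)
    (hβ : δ.comp β = AlgHom.id K A) {f g : A} (hf : α f = β f)
    (hg : IsAlgebraic (Algebra.adjoin K {f}) g) : α g = β g := by
  have : CharZero (Algebra.adjoin K {f}) := Algebra.charZero_of_charZero K _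
  have hα' : ∀ a, δ (α a) = a := fun a => DFunLike.congr_fun hα a
  have hβ' : ∀ a, δ (β a) = a := fun a => DFunLike.congr_fun hβ a
  obtain ⟨p, hp, hp'⟩ := hg.exists_simple_root
  let ρ : Algebra.adjoin K {f} →+* A := algebraMap _ A
  have hρ : (α : A →+* B).comp ρ = (β : A →+* B).comp ρ := by
    ext r
    exact AlgHom.adjoin_le_equalizer α β (s := {f}) (by simpa [Set.EqOn] using hf) r.2
  set q := p.map ((α : A →+* B).comp ρ) with hq
  have evα : ∀ r : Polynomial (Algebra.adjoin K {f}),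
      (r.map ((α : A →+* B).comp ρ)).eval (α g) = α (Polynomial.aeval g r) := by
    intro r
    rw [Polynomial.eval_map, Polynomial.aeval_def]
    exact (Polynomial.hom_eval₂ r ρ (α : A →+* B) g).symm
  have evβ : q.eval (β g) = 0 := by
    rw [hq, hρ, Polynomial.eval_map]
    refine (Polynomial.hom_eval₂ p ρ (β : A →+* B) g).symm.trans ?_
    rw [← Polynomial.aeval_def, hp, map_zero]
  obtain ⟨k, hk⟩ := q.binomExpansion (α g) (β g - α g)
  rw [add_sub_cancel, evβ, hq, evα, hp, map_zero, Polynomial.derivative_map, evα] at hk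
  have hz : (β g - α g) * (α (Polynomial.aeval g (Polynomial.derivative p)) + k * (β g - α g)) = 0 := by
    linear_combination -hk
  rcases mul_eq_zero.1 hz with h | h
  · exact (sub_eq_zero.1 h).symm
  · refine absurd ?_ hp'
    simpa [hα', hβ'] using congrArg δ h

theorem MvPolynomial.totalDegree_aeval_le_of_le_one {R σ τ : Type*} [CommRing R]
    (e : σ → MvPolynomial τ R) (he : ∀ i, (e i).totalDegree ≤ 1) (p : MvPolynomial σ R) :
    (aeval e p).totalDegree ≤ p.totalDegree := by
  rw [aeval_def, eval₂_eq]
  refine totalDegree_finsetSum_le fun d hd => ?_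
  rw [algebraMap_eq]
  refine (totalDegree_mul _ _).trans ?_
  rw [totalDegree_C, zero_add]
  refine (totalDegree_finsetProd _ _).trans ((Finset.sum_le_sum fun i _ => ?_).trans
    (le_totalDegree hd))
  exact (totalDegree_pow _ _).trans (by simpa using Nat.mul_le_mul_left (d i) (he i))

theorem MvPolynomial.totalDegree_pderiv_lt_of_ne_zero {R σ : Type*} [CommRing R] {i : σ}
    {p : MvPolynomial σ R} (h : pderiv i p ≠ 0) : (pderiv i p).totalDegree < p.totalDegree := by
  have key : ∀ m ∈ (pderiv i p).support, (m.sum fun _ e => e) + 1 ≤ p.totalDegree := by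
    intro m hm
    rw [mem_support_iff, coeff_pderiv] at hm
    have := le_totalDegree (mem_support_iff.2 (left_ne_zero_of_mul hm))
    rwa [Finsupp.sum_add_index' (fun _ => rfl) (fun _ _ _ => rfl), Finsupp.sum_single_index rfl]
      at this
  obtain ⟨m, hm⟩ := support_nonempty.2 h
  refine (Finset.sup_lt_iff ?_).2 fun m hm => ?_
  · have := key m hm
    simp only [bot_eq_zero]
    omega
  · exact key m hm

theorem MvPolynomial.pderiv_rename_of_notMem_range {R σ τ : Type*} [CommRing R] {e : σ → τ} {i : τ}
    (hi : i ∉ Set.range e) (p : MvPolynomial σ R) : pderiv i (rename e p) = 0 := by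
  classical
  refine pderiv_eq_zero_of_notMem_vars fun h => hi ?_
  obtain ⟨j, -, hj⟩ := Finset.mem_image.1 (vars_rename _ _ h)
  exact ⟨j, hj⟩

/-- The `2 × 2` minors of a matrix of rank at most one vanish. -/
theorem Matrix.mul_eq_mul_of_rank_le_one {F m n : Type*} [Field F] [Fintype n]
    {M : Matrix m n F} (hM : M.rank ≤ 1) (i i' : m) (j j' : n) :
    M i j * M i' j' = M i j' * M i' j := by
  by_contra hne
  have hdet : IsUnit (M.submatrix ![i, i'] ![j, j']).det := by
    rw [isUnit_iff_ne_zero, Matrix.det_fin_two]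
    simpa [sub_eq_zero] using hne
  have h := Matrix.rank_of_isUnit _ ((Matrix.isUnit_iff_isUnit_det _).2 hdet)
  have h' := Matrix.rank_submatrix_le M ![i, i'] ![j, j']
  simp only [Fintype.card_fin] at h
  omega

/-- If `F ≠ 0` is killed by a ring homomorphism into a domain, so is one of its prime factors. -/
theorem exists_prime_dvd_of_map_eq_zero {S A : Type*} [CommRing S] [IsDomain S]
    [UniqueFactorizationMonoid S] [CommRing A] [IsDomain A] (δ : S →+* A) {F : S} (hF : F ≠ 0)
    (hδ : δ F = 0) : ∃ P, Prime P ∧ P ∣ F ∧ δ P = 0 := by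
  induction F using UniqueFactorizationMonoid.induction_on_prime with
  | h₁ => exact absurd rfl hF
  | h₂ x hx => exact absurd hδ (hx.map δ).ne_zero
  | h₃ a p ha hp ih =>
    rw [map_mul, mul_eq_zero] at hδ
    rcases hδ with h | h
    · exact ⟨p, hp, dvd_mul_right _ _, h⟩
    · obtain ⟨P, h1, h2, h3⟩ := ih ha h
      exact ⟨P, h1, h2.mul_left _, h3⟩

/-- A prime factor of `f(x) - f(y)` vanishing on the diagonal divides `g(x) - g(y)` for every `g`
algebraic over `f`. -/
theorem MvPolynomial.prime_dvd_rename_sub_rename {K σ : Type*} [Field K] [CharZero K]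
    {f g : MvPolynomial σ K} (hg : IsAlgebraic (Algebra.adjoin K {f}) g)
    {P : MvPolynomial (σ ⊕ σ) K} (hP : Prime P)
    (hPf : P ∣ rename Sum.inl f - rename Sum.inr f) (hδ : rename (Sum.elim id id) P = 0) :
    P ∣ rename Sum.inl g - rename Sum.inr g := by
  have hprime : (Ideal.span {P}).IsPrime := (Ideal.span_singleton_prime hP.ne_zero).2 hP
  let π : MvPolynomial (σ ⊕ σ) K →ₐ[K] MvPolynomial (σ ⊕ σ) K ⧸ Ideal.span {P} :=
    Ideal.Quotient.mkₐ K _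
  have hπ : ∀ a b, π a = π b ↔ P ∣ a - b := fun a b =>
    Ideal.Quotient.eq.trans Ideal.mem_span_singleton
  let δ : (MvPolynomial (σ ⊕ σ) K ⧸ Ideal.span {P}) →ₐ[K] MvPolynomial σ K :=
    Ideal.Quotient.liftₐ _ (rename (Sum.elim id id)) fun a ha => by
      obtain ⟨c, rfl⟩ := Ideal.mem_span_singleton.1 ha
      rw [map_mul, hδ, zero_mul]
  have hδπ : ∀ a, δ (π a) = rename (Sum.elim id id) a := fun a => rfl
  refine (hπ _ _).1 (AlgHom.eq_of_section_of_isAlgebraic (π.comp (rename Sum.inl))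
    (π.comp (rename Sum.inr)) δ ?_ ?_ ((hπ _ _).2 hPf) hg)
  · ext i : 1
    simp [hδπ]
  · ext i : 1
    simp [hδπ]

/-- If `H` is annihilated by its Jacobian and all `∇ H_l` are parallel to `∇ f`, where
`∇ f · H = 0`, then `∇ f (x) · H (y) = 0`. -/
theorem sum_rename_pderiv_mul_rename_eq_zero {K : Type*} [Field K] [CharZero K] {n : ℕ}
    (H : Fin n → MvPolynomial (Fin n) K) (f : MvPolynomial (Fin n) K)
    (hf : ∑ j, pderiv j f * H j = 0)
    (hpar : ∀ l j k, pderiv j f * pderiv k (H l) = pderiv k f * pderiv j (H l)) :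
    ∑ j, rename (Sum.inl : Fin n → Fin n ⊕ Fin n) (pderiv j f) * rename Sum.inr (H j) = 0 := by
  by_cases hgrad : ∀ i, pderiv i f = 0
  · simp [hgrad]
  push Not at hgrad
  obtain ⟨i, hi⟩ := hgrad
  have hfC : ∀ c : K, f - C c ≠ 0 := by
    intro c h
    apply hi
    rw [sub_eq_zero.1 h, pderiv_C]
  have hdiag : ∀ p : MvPolynomial (Fin n) K,
      rename (Sum.elim id id) (rename (Sum.inl : Fin n → Fin n ⊕ Fin n) p) = p ∧
      rename (Sum.elim id id) (rename (Sum.inr : Fin n → Fin n ⊕ Fin n) p) = p := by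
    intro p
    simp [rename_rename]
  let ε (η : Fin n → K) : MvPolynomial (Fin n ⊕ Fin n) K →ₐ[K] MvPolynomial (Fin n) K :=
    aeval (Sum.elim X (C ∘ η))
  have hεl : ∀ η p, ε η (rename Sum.inl p) = p := by
    intro η p
    simp only [ε, aeval_rename]
    exact aeval_X_left_apply p
  have hεr : ∀ η p, ε η (rename Sum.inr p) = C (eval η p) := by
    intro η p
    simp only [ε, aeval_rename]
    induction p using MvPolynomial.induction_on <;> simp_all [algebraMap_eq]
  have hεdeg : ∀ η p, (ε η p).totalDegree ≤ p.totalDegree := by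
    intro η p
    refine totalDegree_aeval_le_of_le_one _ ?_ p
    rintro (k | k) <;> simp
  set F : MvPolynomial (Fin n ⊕ Fin n) K := rename Sum.inl f - rename Sum.inr f with hFdef
  have hεF : ∀ η, ε η F = f - C (eval η f) := by
    intro η
    rw [hFdef, map_sub, hεl, hεr]
  have hF0 : F ≠ 0 := by
    intro h
    apply hfC (eval 0 f)
    rw [← hεF, h, map_zero]
  obtain ⟨P, hP, hPF, hPδ⟩ := exists_prime_dvd_of_map_eq_zero
    (rename (R := K) (Sum.elim id id : Fin n ⊕ Fin n → Fin n)).toRingHom hF0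
    (by simp [hFdef, hdiag])
  replace hPδ : rename (Sum.elim id id) P = 0 := hPδ
  have hPH : ∀ l, P ∣ rename Sum.inr (H l) - rename Sum.inl (H l) := fun l =>
    dvd_sub_comm.1 (prime_dvd_rename_sub_rename
      (isAlgebraic_adjoin_of_pderiv_mul_eq hi (hpar l)) hP hPF hPδ)
  obtain ⟨Q, hQ⟩ := hPF
  have hPdeg : ∀ η, P.totalDegree ≤ (ε η P).totalDegree := by
    intro η
    have hPQ : ε η P * ε η Q = f - C (eval η f) := by rw [← map_mul, ← hQ, hεF]
    have hne : ε η P * ε η Q ≠ 0 := hPQ ▸ hfC _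
    have h1 : F.totalDegree ≤ f.totalDegree :=
      (totalDegree_sub _ _).trans (max_le (totalDegree_rename_le _ _) (totalDegree_rename_le _ _))
    have h2 : f.totalDegree ≤ (f - C (eval η f)).totalDegree := by
      have := totalDegree_add (f - C (eval η f)) (C (eval η f))
      simpa using this
    have hQ0 : Q ≠ 0 := right_ne_zero_of_mul (hQ ▸ hF0)
    rw [hQ, totalDegree_mul_of_isDomain hP.ne_zero hQ0] at h1
    rw [← hPQ, totalDegree_mul_of_isDomain (left_ne_zero_of_mul hne)
      (right_ne_zero_of_mul hne)] at h2
    have h3 := hεdeg η Q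
    omega
  set m := rename (Sum.elim id id) Q with hm
  set w : Fin n → MvPolynomial (Fin n) K :=
    fun j => rename (Sum.elim id id) (pderiv (Sum.inl j) P) with hw
  have hmw : ∀ j, pderiv j f = m * w j := by
    intro j
    have h1 : pderiv (Sum.inl j) F = rename Sum.inl (pderiv j f) := by
      rw [hFdef, map_sub, pderiv_rename Sum.inl_injective,
        pderiv_rename_of_notMem_range (by simp), sub_zero]
    have h2 := congrArg (rename (Sum.elim id id)) (congrArg (pderiv (Sum.inl j)) hQ)
    rw [h1, (hdiag _).1, pderiv_mul, map_add, map_mul, map_mul, hPδ, zero_mul, add_zero] at h2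
    rw [h2, mul_comm]
  have hm0 : m ≠ 0 := left_ne_zero_of_mul (hmw i ▸ hi)
  have hwH : ∑ j, w j * H j = 0 := by
    refine (mul_eq_zero.1 (?_ : m * ∑ j, w j * H j = 0)).resolve_left hm0
    rw [Finset.mul_sum, ← hf]
    exact Finset.sum_congr rfl fun j _ => by rw [hmw]; ring
  have hwdeg : ∀ j, w j ≠ 0 → (w j).totalDegree < P.totalDegree := by
    intro j hj
    refine (totalDegree_rename_le _ _).trans_lt (totalDegree_pderiv_lt_of_ne_zero fun h => hj ?_)
    rw [hw]
    simp only [h, map_zero]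
  have hdvd : P ∣ ∑ j, rename Sum.inl (w j) * rename Sum.inr (H j) := by
    have h0 : ∑ j, rename (Sum.inl : Fin n → Fin n ⊕ Fin n) (w j) * rename Sum.inl (H j) = 0 := by
      simpa using congrArg (rename (Sum.inl : Fin n → Fin n ⊕ Fin n)) hwH
    rw [← sub_zero (∑ j, rename Sum.inl (w j) * rename Sum.inr (H j)), ← h0,
      ← Finset.sum_sub_distrib]
    exact Finset.dvd_sum fun j _ => by
      rw [← mul_sub]
      exact (hPH j).mul_left _
  have hε0 : ∀ η, ε η (∑ j, rename Sum.inl (w j) * rename Sum.inr (H j)) = 0 := by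
    intro η
    by_contra hne
    obtain ⟨U, hU⟩ := hdvd
    have hlt : (ε η (∑ j, rename Sum.inl (w j) * rename Sum.inr (H j))).totalDegree
        < P.totalDegree := by
      rw [map_sum] at hne ⊢
      obtain ⟨j₀, -, hj₀⟩ := Finset.exists_ne_zero_of_sum_ne_zero hne
      have hpos : 0 < P.totalDegree := by
        refine (Nat.zero_le _).trans_lt (hwdeg j₀ fun h => hj₀ ?_)
        rw [h, map_zero, zero_mul, map_zero]
      refine (Nat.lt_iff_le_pred hpos).2 (totalDegree_finsetSum_le fun j _ => ?_)
      rw [map_mul, hεl, hεr]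
      by_cases hj : w j = 0
      · simp [hj]
      · have h1 := totalDegree_mul (w j) (C (eval η (H j)))
        rw [totalDegree_C, add_zero] at h1
        have := hwdeg j hj
        omega
    rw [hU, map_mul] at hne hlt
    rw [totalDegree_mul_of_isDomain (left_ne_zero_of_mul hne) (right_ne_zero_of_mul hne)] at hlt
    have := hPdeg η
    omega
  have hzero : ∑ j, rename (Sum.inl : Fin n → Fin n ⊕ Fin n) (w j) * rename Sum.inr (H j) = 0 := by
    refine MvPolynomial.funext fun ξ => ?_
    have h := congrArg (eval (ξ ∘ Sum.inl)) (hε0 (ξ ∘ Sum.inr))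
    rw [map_sum, map_sum] at h
    simpa [hεl, hεr, eval_rename] using h
  calc ∑ j, rename (Sum.inl : Fin n → Fin n ⊕ Fin n) (pderiv j f) * rename Sum.inr (H j)
      = rename Sum.inl m * ∑ j, rename Sum.inl (w j) * rename Sum.inr (H j) := by
        rw [Finset.mul_sum]
        exact Finset.sum_congr rfl fun j _ => by rw [hmw, map_mul, mul_assoc]
    _ = 0 := by rw [hzero, mul_zero]

theorem stmt19 {K : Type} [Field K] [CharZero K] {n : ℕ}
    (H : Fin n → MvPolynomial (Fin n) K)
    (hq : (jac H).mulVec H = 0)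
    (hrank : ((jac H).map (algebraMap (MvPolynomial (Fin n) K)
        (FractionRing (MvPolynomial (Fin n) K)))).rank = 1) :
    jacX H * jacY H = 0 := by
  have hpar : ∀ i l j k, pderiv j (H i) * pderiv k (H l) = pderiv k (H i) * pderiv j (H l) := by
    intro i l j k
    apply IsFractionRing.injective (MvPolynomial (Fin n) K) (FractionRing (MvPolynomial (Fin n) K))
    simpa [jac] using Matrix.mul_eq_mul_of_rank_le_one hrank.le i l j k
  ext1 i k
  have h := sum_rename_pderiv_mul_rename_eq_zero H (H i)
    (by simpa [jac, Matrix.mulVec, dotProduct] using congrFun hq i) (hpar i)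
  have h' := congrArg (pderiv (Sum.inr k)) h
  rw [map_sum, map_zero] at h'
  rw [Matrix.zero_apply, Matrix.mul_apply, ← h']
  refine Finset.sum_congr rfl fun j _ => ?_
  rw [pderiv_mul, pderiv_rename_of_notMem_range (by simp), zero_mul, zero_add, pderiv_rename Sum.inr_injective]
  rfl
end
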